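/- Lemma (bad grid instances are unsolvable): If (G,T) is a bad grid instance, where G = P_p □ P_q is a grid and T ⊆ V(G), then G does not admit any acyclic T-odd orientation. -/

import Mathlib

open SimpleGraph

section Defs

variable {V : Type*}

/-- An orientation of a simple graph: each edge gets exactly one direction. -/
structure GraphOrientation {V : Type*} (G : SimpleGraph V) where
  dir : V → V → Prop
  dir_adj : ∀ u v, dir u v → G.Adj u v
  dir_choice : ∀ u v, G.Adj u v → (dir u v ↔ ¬ dir v u)

/-- An orientation is acyclic if there is no directed cycle, i.e. the transitive
closure of the arc relation is irreflexive. -/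
def GraphOrientation.Acyclic {G : SimpleGraph V} (o : GraphOrientation G) : Prop :=
  Irreflexive (Relation.TransGen o.dir)

/-- In-degree of a vertex in an orientation. -/
noncomputable def GraphOrientation.indeg {G : SimpleGraph V} (o : GraphOrientation G)
    (v : V) : ℕ :=
  Set.ncard {u | o.dir u v}

/-- An orientation is `T`-odd if a vertex has odd in-degree iff it belongs to `T`. -/
def GraphOrientation.IsTOdd {G : SimpleGraph V} (o : GraphOrientation G) (T : Set V) : Prop :=
  ∀ v, Odd (o.indeg v) ↔ v ∈ T

/-- `G` admits an acyclic `T`-odd orientation. -/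
def HasAcyclicTOddOrientation (G : SimpleGraph V) (T : Set V) : Prop :=
  ∃ o : GraphOrientation G, o.Acyclic ∧ o.IsTOdd T

/-- Degree of a vertex. -/
noncomputable def vdeg (G : SimpleGraph V) (v : V) : ℕ := (G.neighborSet v).ncard

/-- Potential sources: `V \ T`. -/
def sourceSet (T : Set V) : Set V := Tᶜ

/-- Potential sinks. -/
def sinkSet (G : SimpleGraph V) (T : Set V) : Set V :=
  {v | (v ∈ T ∧ Odd (vdeg G v)) ∨ (v ∉ T ∧ Even (vdeg G v))}

/-- Parity condition `𝒫`: `|E| + |T|` is even. -/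
def CondP (G : SimpleGraph V) (T : Set V) : Prop :=
  Even (G.edgeSet.ncard + T.ncard)

/-- Source condition `𝒮`. -/
def CondS (G : SimpleGraph V) (T : Set V) : Prop :=
  (sourceSet T).Nonempty ∧
    ((sourceSet T).ncard = 1 → Nat.card V = 1 ∨ sourceSet T ≠ sinkSet G T)

/-- Sink condition `𝒮̄`. -/
def CondSbar (G : SimpleGraph V) (T : Set V) : Prop :=
  (sinkSet G T).Nonempty ∧
    ((sinkSet G T).ncard = 1 → Nat.card V = 1 ∨ sinkSet G T ≠ sourceSet T)

/-- Membership in the class `C_P`. -/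
def MemCP (G : SimpleGraph V) : Prop :=
  ∀ T : Set V, CondP G T → HasAcyclicTOddOrientation G T

/-- Membership in the class `C_{P,S}`. -/
def MemCPS (G : SimpleGraph V) : Prop :=
  ∀ T : Set V, CondP G T → CondS G T → HasAcyclicTOddOrientation G T

/-- Membership in the class `C_{P,S̄}`. -/
def MemCPSbar (G : SimpleGraph V) : Prop :=
  ∀ T : Set V, CondP G T → CondSbar G T → HasAcyclicTOddOrientation G T

/-- Membership in the class `C_{P,S,S̄}`. -/
def MemCPSSbar (G : SimpleGraph V) : Prop :=
  ∀ T : Set V, CondP G T → CondS G T → CondSbar G T → HasAcyclicTOddOrientation G T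

/-- A graph is Eulerian if it is connected and every vertex has even degree. -/
def IsEulerianGraph (G : SimpleGraph V) : Prop :=
  G.Connected ∧ ∀ v : V, Even (vdeg G v)

end Defs

section BadGrid

/-- A path instance on vertices `w_0, …, w_{h-1}` (membership in `T` given by `inT`)
is a *bad path instance*. -/
def BadPathInstance (h : ℕ) (inT : ℕ → Prop) : Prop :=
  Even h ∧ inT 0 ∧ inT (h - 1) ∧
    ∀ k : ℕ, 1 ≤ k → k ≤ (h - 2) / 2 → (inT (2 * k - 1) ↔ inT (2 * k))

/-- Trace of `T` on the boundary row `j = 0` of the grid `P_p □ P_q`. -/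
def gridRow0 (p q : ℕ) (T : Set (Fin p × Fin q)) : ℕ → Prop :=
  fun i => ∃ (hi : i < p) (hj : 0 < q), (⟨i, hi⟩, ⟨0, hj⟩) ∈ T

/-- Trace of `T` on the boundary row `j = q - 1` of the grid `P_p □ P_q`. -/
def gridRowLast (p q : ℕ) (T : Set (Fin p × Fin q)) : ℕ → Prop :=
  fun i => ∃ (hi : i < p) (hj : q - 1 < q), (⟨i, hi⟩, ⟨q - 1, hj⟩) ∈ T

/-- Trace of `T` on the boundary column `i = 0` of the grid `P_p □ P_q`. -/
def gridCol0 (p q : ℕ) (T : Set (Fin p × Fin q)) : ℕ → Prop :=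
  fun j => ∃ (hi : 0 < p) (hj : j < q), (⟨0, hi⟩, ⟨j, hj⟩) ∈ T

/-- Trace of `T` on the boundary column `i = p - 1` of the grid `P_p □ P_q`. -/
def gridColLast (p q : ℕ) (T : Set (Fin p × Fin q)) : ℕ → Prop :=
  fun j => ∃ (hi : p - 1 < p) (hj : j < q), (⟨p - 1, hi⟩, ⟨j, hj⟩) ∈ T

/-- `(P_p □ P_q, T)` is a *bad grid instance*. -/
def BadGridInstance (p q : ℕ) (T : Set (Fin p × Fin q)) : Prop :=
  Even p ∧ Even q ∧
  (∀ (i : Fin p) (j : Fin q), 1 ≤ (i : ℕ) → (i : ℕ) ≤ p - 2 →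
      1 ≤ (j : ℕ) → (j : ℕ) ≤ q - 2 → (i, j) ∈ T) ∧
  BadPathInstance p (gridRow0 p q T) ∧
  BadPathInstance p (gridRowLast p q T) ∧
  BadPathInstance q (gridCol0 p q T) ∧
  BadPathInstance q (gridColLast p q T)

end BadGrid

/-- Summing over the corners of two complementary families of grid faces (the even-even ones and
the odd-odd ones) gives a contradiction as soon as each face carries at most two marked corners,
each interior vertex is marked once, each boundary pair is marked once, and the four corner
vertices are marked. -/
theorem false_of_marked_face_corners (M N : ℕ) (a b c d : ℕ → ℕ → ℕ)
    (face : ∀ i j, i ≤ 2 * M → j ≤ 2 * N → a i j + b i j + c i j + d i j ≤ 2)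
    (int₁ : ∀ i j, i < 2 * M → j < 2 * N → d i j + a (i + 1) (j + 1) = 1)
    (int₂ : ∀ i j, i < 2 * M → j < 2 * N → c (i + 1) j + b i (j + 1) = 1)
    (bot : ∀ k < M, b (2 * k) 0 + a (2 * k + 2) 0 = 1)
    (top : ∀ k < M, d (2 * k) (2 * N) + c (2 * k + 2) (2 * N) = 1)
    (left : ∀ l < N, c 0 (2 * l) + a 0 (2 * l + 2) = 1)
    (right : ∀ l < N, d (2 * M) (2 * l) + b (2 * M) (2 * l + 2) = 1)
    (ha : a 0 0 = 1) (hb : b (2 * M) 0 = 1) (hc : c 0 (2 * N) = 1)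
    (hd : d (2 * M) (2 * N) = 1) : False := by
  have sum_one : ∀ (n : ℕ) (f g : ℕ → ℕ), (∀ k < n, f k + g k = 1) →
      ∑ k ∈ Finset.range n, f k + ∑ k ∈ Finset.range n, g k = n := by
    intro n f g h
    rw [← Finset.sum_add_distrib, Finset.sum_congr rfl fun k hk => h k (Finset.mem_range.1 hk)]
    simp
  have sum_one₂ : ∀ f g : ℕ → ℕ → ℕ, (∀ k < M, ∀ l < N, f k l + g k l = 1) →
      ∑ k ∈ Finset.range M, ∑ l ∈ Finset.range N, f k l
        + ∑ k ∈ Finset.range M, ∑ l ∈ Finset.range N, g k l = M * N := by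
    intro f g h
    rw [← Finset.sum_add_distrib, Finset.sum_congr rfl fun k hk =>
      sum_one N (f k) (g k) (h k (Finset.mem_range.1 hk))]
    simp
  have sum_le : ∀ (m n : ℕ) (f : ℕ → ℕ → ℕ), (∀ k < m, ∀ l < n, f k l ≤ 2) →
      ∑ k ∈ Finset.range m, ∑ l ∈ Finset.range n, f k l ≤ m * n * 2 := by
    intro m n f h
    calc _ ≤ ∑ k ∈ Finset.range m, ∑ l ∈ Finset.range n, 2 :=
          Finset.sum_le_sum fun k hk => Finset.sum_le_sum fun l hl =>
            h k (Finset.mem_range.1 hk) l (Finset.mem_range.1 hl)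
      _ = m * n * 2 := by simp [mul_assoc]
  have even_faces := sum_le (M + 1) (N + 1)
    (fun k l => a (2 * k) (2 * l) + b (2 * k) (2 * l) + c (2 * k) (2 * l) + d (2 * k) (2 * l))
    fun k hk l hl => face _ _ (by omega) (by omega)
  have odd_faces := sum_le M N
    (fun k l => a (2 * k + 1) (2 * l + 1) + b (2 * k + 1) (2 * l + 1)
      + c (2 * k + 1) (2 * l + 1) + d (2 * k + 1) (2 * l + 1))
    fun k hk l hl => face _ _ (by omega) (by omega)
  have i₁ := sum_one₂ (fun k l => d (2 * k) (2 * l)) (fun k l => a (2 * k + 1) (2 * l + 1))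
    fun k hk l hl => int₁ _ _ (by omega) (by omega)
  have i₂ := sum_one₂ (fun k l => d (2 * k + 1) (2 * l + 1))
    (fun k l => a (2 * (k + 1)) (2 * (l + 1)))
    fun k hk l hl => int₁ (2 * k + 1) (2 * l + 1) (by omega) (by omega)
  have i₃ := sum_one₂ (fun k l => c (2 * (k + 1)) (2 * l)) (fun k l => b (2 * k + 1) (2 * l + 1))
    fun k hk l hl => int₂ (2 * k + 1) (2 * l) (by omega) (by omega)
  have i₄ := sum_one₂ (fun k l => c (2 * k + 1) (2 * l + 1)) (fun k l => b (2 * k) (2 * (l + 1)))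
    fun k hk l hl => int₂ (2 * k) (2 * l + 1) (by omega) (by omega)
  have b₁ := sum_one M (fun k => b (2 * k) 0) (fun k => a (2 * (k + 1)) 0) bot
  have b₂ := sum_one M (fun k => d (2 * k) (2 * N)) (fun k => c (2 * (k + 1)) (2 * N)) top
  have b₃ := sum_one N (fun l => c 0 (2 * l)) (fun l => a 0 (2 * (l + 1))) left
  have b₄ := sum_one N (fun l => d (2 * M) (2 * l)) (fun l => b (2 * M) (2 * (l + 1))) right
  have ea : ∑ k ∈ Finset.range (M + 1), ∑ l ∈ Finset.range (N + 1), a (2 * k) (2 * l)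
      = ∑ k ∈ Finset.range M, ∑ l ∈ Finset.range N, a (2 * (k + 1)) (2 * (l + 1))
        + ∑ k ∈ Finset.range M, a (2 * (k + 1)) 0 + ∑ l ∈ Finset.range N, a 0 (2 * (l + 1))
        + 1 := by
    simp only [Finset.sum_range_succ', Finset.sum_add_distrib, mul_zero, ha]
    omega
  have eb : ∑ k ∈ Finset.range (M + 1), ∑ l ∈ Finset.range (N + 1), b (2 * k) (2 * l)
      = ∑ k ∈ Finset.range M, ∑ l ∈ Finset.range N, b (2 * k) (2 * (l + 1))
        + ∑ k ∈ Finset.range M, b (2 * k) 0 + ∑ l ∈ Finset.range N, b (2 * M) (2 * (l + 1))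
        + 1 := by
    rw [Finset.sum_range_succ]
    simp only [Finset.sum_range_succ' _ N, Finset.sum_add_distrib, mul_zero, hb]
    omega
  have ec : ∑ k ∈ Finset.range (M + 1), ∑ l ∈ Finset.range (N + 1), c (2 * k) (2 * l)
      = ∑ k ∈ Finset.range M, ∑ l ∈ Finset.range N, c (2 * (k + 1)) (2 * l)
        + ∑ k ∈ Finset.range M, c (2 * (k + 1)) (2 * N) + ∑ l ∈ Finset.range N, c 0 (2 * l)
        + 1 := by
    rw [Finset.sum_range_succ']
    simp only [Finset.sum_range_succ _ N, Finset.sum_add_distrib, mul_zero, hc]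
    omega
  have ed : ∑ k ∈ Finset.range (M + 1), ∑ l ∈ Finset.range (N + 1), d (2 * k) (2 * l)
      = ∑ k ∈ Finset.range M, ∑ l ∈ Finset.range N, d (2 * k) (2 * l)
        + ∑ k ∈ Finset.range M, d (2 * k) (2 * N) + ∑ l ∈ Finset.range N, d (2 * M) (2 * l)
        + 1 := by
    simp only [Finset.sum_range_succ, Finset.sum_add_distrib, hd]
    omega
  simp only [Finset.sum_add_distrib] at even_faces odd_faces
  have hmul : (M + 1) * (N + 1) * 2 = M * N * 2 + M * 2 + N * 2 + 2 := by ring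
  omega

section GridOrientation

variable {p q : ℕ}

/-- The arc relation of an orientation of a grid, in natural number coordinates. -/
def GraphOrientation.arc (o : GraphOrientation (pathGraph p □ pathGraph q)) (x y x' y' : ℕ) :
    Prop :=
  ∃ (hx : x < p) (hy : y < q) (hx' : x' < p) (hy' : y' < q),
    o.dir (⟨x, hx⟩, ⟨y, hy⟩) (⟨x', hx'⟩, ⟨y', hy'⟩)

/-- Membership in a set of grid vertices, in natural number coordinates. -/
def gridMem (T : Set (Fin p × Fin q)) (x y : ℕ) : Prop :=
  ∃ (hx : x < p) (hy : y < q), (⟨x, hx⟩, ⟨y, hy⟩) ∈ T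

namespace GraphOrientation

variable (o : GraphOrientation (pathGraph p □ pathGraph q))

theorem arc_right_iff {x y : ℕ} (hx : x + 1 < p) (hy : y < q) :
    o.arc (x + 1) y x y ↔ ¬ o.arc x y (x + 1) y := by
  have h := o.dir_choice (⟨x + 1, hx⟩, ⟨y, hy⟩) (⟨x, by omega⟩, ⟨y, hy⟩)
    (by simp [boxProd_adj, pathGraph_adj])
  have hx' : x < p := by omega
  simpa [arc, hx, hy, hx'] using h

theorem arc_up_iff {x y : ℕ} (hx : x < p) (hy : y + 1 < q) :
    o.arc x (y + 1) x y ↔ ¬ o.arc x y x (y + 1) := by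
  have h := o.dir_choice (⟨x, hx⟩, ⟨y + 1, hy⟩) (⟨x, hx⟩, ⟨y, by omega⟩)
    (by simp [boxProd_adj, pathGraph_adj])
  have hy' : y < q := by omega
  simpa [arc, hx, hy, hy'] using h

variable {o} in
theorem Acyclic.not_four_cycle (ho : o.Acyclic) {x₁ y₁ x₂ y₂ x₃ y₃ x₄ y₄ : ℕ}
    (h₁ : o.arc x₁ y₁ x₂ y₂) (h₂ : o.arc x₂ y₂ x₃ y₃) (h₃ : o.arc x₃ y₃ x₄ y₄)
    (h₄ : o.arc x₄ y₄ x₁ y₁) : False := by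
  obtain ⟨_, _, _, _, h₁⟩ := h₁
  obtain ⟨_, _, _, _, h₂⟩ := h₂
  obtain ⟨_, _, _, _, h₃⟩ := h₃
  obtain ⟨_, _, _, _, h₄⟩ := h₄
  exact ho _ ((((Relation.TransGen.single h₁).tail h₂).tail h₃).tail h₄)

open Classical in
theorem ncard_arc (a b x y : ℕ) (hx : x < p) (hy : y < q) :
    {u : Fin p × Fin q | (u.1 : ℕ) = a ∧ (u.2 : ℕ) = b ∧
      o.dir u (⟨x, hx⟩, ⟨y, hy⟩)}.ncard = if o.arc a b x y then 1 else 0 := by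
  split_ifs with h
  · obtain ⟨ha, hb, _, _, h⟩ := h
    rw [Set.ncard_eq_one]
    refine ⟨(⟨a, ha⟩, ⟨b, hb⟩), ?_⟩
    ext ⟨⟨u, hu⟩, ⟨v, hv⟩⟩
    simp only [Set.mem_ofPred_eq, Set.mem_singleton_iff, Prod.mk.injEq, Fin.mk.injEq]
    constructor
    · tauto
    · rintro ⟨rfl, rfl⟩
      exact ⟨rfl, rfl, h⟩
  · rw [Set.ncard_eq_zero]
    ext ⟨⟨u, hu⟩, ⟨v, hv⟩⟩
    simp only [Set.mem_ofPred_eq, Set.mem_empty_iff_false, iff_false]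
    rintro ⟨rfl, rfl, h'⟩
    exact h ⟨hu, hv, hx, hy, h'⟩

open Classical in
theorem indeg_eq (x y : ℕ) (hx : x < p) (hy : y < q) :
    o.indeg (⟨x, hx⟩, ⟨y, hy⟩) =
      (if 0 < x ∧ o.arc (x - 1) y x y then 1 else 0) + (if o.arc (x + 1) y x y then 1 else 0)
      + (if 0 < y ∧ o.arc x (y - 1) x y then 1 else 0)
      + (if o.arc x (y + 1) x y then 1 else 0) := by
  have hsplit : {u | o.dir u (⟨x, hx⟩, ⟨y, hy⟩)} =
      (({u : Fin p × Fin q | 0 < x ∧ (u.1 : ℕ) = x - 1 ∧ (u.2 : ℕ) = y ∧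
          o.dir u (⟨x, hx⟩, ⟨y, hy⟩)} ∪
        {u : Fin p × Fin q | (u.1 : ℕ) = x + 1 ∧ (u.2 : ℕ) = y ∧
          o.dir u (⟨x, hx⟩, ⟨y, hy⟩)}) ∪
        {u : Fin p × Fin q | 0 < y ∧ (u.1 : ℕ) = x ∧ (u.2 : ℕ) = y - 1 ∧
          o.dir u (⟨x, hx⟩, ⟨y, hy⟩)}) ∪
        {u : Fin p × Fin q | (u.1 : ℕ) = x ∧ (u.2 : ℕ) = y + 1 ∧
          o.dir u (⟨x, hx⟩, ⟨y, hy⟩)} := by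
    ext ⟨⟨u, hu⟩, ⟨v, hv⟩⟩
    simp only [Set.mem_ofPred_eq, Set.mem_union]
    constructor
    · intro h
      have hadj := o.dir_adj _ _ h
      simp only [boxProd_adj, pathGraph_adj, Fin.mk.injEq] at hadj
      simp only [h, and_true]
      omega
    · tauto
  have guard : ∀ (P : Prop) (s : Set (Fin p × Fin q)),
      {u | P ∧ u ∈ s}.ncard = if P then s.ncard else 0 := by
    intro P s
    split_ifs with h <;> simp [h]
  have card₁ := guard (0 < x) {u | (u.1 : ℕ) = x - 1 ∧ (u.2 : ℕ) = y ∧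
    o.dir u (⟨x, hx⟩, ⟨y, hy⟩)}
  have card₂ := guard (0 < y) {u | (u.1 : ℕ) = x ∧ (u.2 : ℕ) = y - 1 ∧
    o.dir u (⟨x, hx⟩, ⟨y, hy⟩)}
  simp only [Set.mem_ofPred_eq, ncard_arc, ← ite_and] at card₁ card₂
  rw [indeg, hsplit, Set.ncard_union_eq, Set.ncard_union_eq, Set.ncard_union_eq, card₁, card₂,
    ncard_arc, ncard_arc]
  all_goals
    rw [Set.disjoint_left]
    simp only [Set.mem_ofPred_eq, Set.mem_union]
    intro u
    omega

end GraphOrientation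

end GridOrientation

set_option maxHeartbeats 2000000 in
/-- Lemma: bad grid instances admit no acyclic `T`-odd orientation. -/
theorem badGrid_unsolvable (p q : ℕ) (T : Set (Fin p × Fin q))
    (hbad : BadGridInstance p q T) :
    ¬ HasAcyclicTOddOrientation (pathGraph p □ pathGraph q) T := by
  classical
  rintro ⟨o, hac, hodd⟩
  obtain ⟨hp, hq, hint, ⟨-, h00, hp0, hbot⟩, ⟨-, h0q, hpq, htop⟩, ⟨-, -, -, hleft⟩,
    ⟨-, -, -, hright⟩⟩ := hbad
  obtain ⟨M, rfl⟩ : ∃ M, p = 2 * M + 2 := by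
    obtain ⟨hp', -⟩ := h00
    obtain ⟨m, rfl⟩ := hp
    exact ⟨m - 1, by omega⟩
  obtain ⟨N, rfl⟩ : ∃ N, q = 2 * N + 2 := by
    obtain ⟨-, hq', -⟩ := h00
    obtain ⟨n, rfl⟩ := hq
    exact ⟨n - 1, by omega⟩
  have par : ∀ x y, x < 2 * M + 2 → y < 2 * N + 2 →
      (Odd ((if 0 < x ∧ o.arc (x - 1) y x y then 1 else 0)
        + (if o.arc (x + 1) y x y then 1 else 0)
        + (if 0 < y ∧ o.arc x (y - 1) x y then 1 else 0)
        + (if o.arc x (y + 1) x y then 1 else 0)) ↔ gridMem T x y) := by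
    intro x y hx hy
    rw [← o.indeg_eq x y hx hy, hodd]
    simp [gridMem, hx, hy]
  have hxe : ∀ y, ¬ o.arc (2 * M + 1 + 1) y (2 * M + 1) y := by
    rintro y ⟨h, -⟩
    omega
  have hye : ∀ x, ¬ o.arc x (2 * N + 1 + 1) x (2 * N + 1) := by
    rintro x ⟨-, h, -⟩
    omega
  replace hbot : ∀ k < M, gridMem T (2 * k + 1) 0 ↔ gridMem T (2 * k + 1 + 1) 0 := fun k hk =>
    hbot (k + 1) (by omega) (by omega)
  replace htop : ∀ k < M, gridMem T (2 * k + 1) (2 * N + 1) ↔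
      gridMem T (2 * k + 1 + 1) (2 * N + 1) := fun k hk =>
    htop (k + 1) (by omega) (by omega)
  replace hleft : ∀ l < N, gridMem T 0 (2 * l + 1) ↔ gridMem T 0 (2 * l + 1 + 1) := fun l hl =>
    hleft (l + 1) (by omega) (by omega)
  replace hright : ∀ l < N, gridMem T (2 * M + 1) (2 * l + 1) ↔
      gridMem T (2 * M + 1) (2 * l + 1 + 1) := fun l hl =>
    hright (l + 1) (by omega) (by omega)
  replace hint : ∀ x y, x < 2 * M → y < 2 * N → gridMem T (x + 1) (y + 1) := fun x y hx hy =>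
    ⟨by omega, by omega, hint _ _ (by simp) (by simp; omega) (by simp) (by simp; omega)⟩
  replace h00 : gridMem T 0 0 := h00
  replace hp0 : gridMem T (2 * M + 1) 0 := hp0
  replace h0q : gridMem T 0 (2 * N + 1) := h0q
  replace hpq : gridMem T (2 * M + 1) (2 * N + 1) := hpq
  have parint : ∀ x y, x < 2 * M → y < 2 * N →
      Odd ((if o.arc x (y + 1) (x + 1) (y + 1) then 1 else 0)
        + (if ¬ o.arc (x + 1) (y + 1) (x + 1 + 1) (y + 1) then 1 else 0)
        + (if o.arc (x + 1) y (x + 1) (y + 1) then 1 else 0)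
        + (if ¬ o.arc (x + 1) (y + 1) (x + 1) (y + 1 + 1) then 1 else 0)) := by
    intro x y hx hy
    have h := (par (x + 1) (y + 1) (by omega) (by omega)).2 (hint x y hx hy)
    rw [o.arc_right_iff (by omega) (by omega), o.arc_up_iff (by omega) (by omega)] at h
    simp only [Nat.succ_pos, true_and, Nat.add_sub_cancel] at h
    convert h
  -- Mark the corner of a face when exactly one of the two face edges there enters it.
  refine false_of_marked_face_corners M N
    (fun i j => if o.arc i j (i + 1) j ↔ o.arc i j i (j + 1) then 0 else 1)
    (fun i j => if o.arc i j (i + 1) j ↔ o.arc (i + 1) j (i + 1) (j + 1) then 1 else 0)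
    (fun i j => if o.arc i (j + 1) (i + 1) (j + 1) ↔ o.arc i j i (j + 1) then 1 else 0)
    (fun i j => if o.arc i (j + 1) (i + 1) (j + 1) ↔ o.arc (i + 1) j (i + 1) (j + 1)
      then 0 else 1) ?_ ?_ ?_ ?_ ?_ ?_ ?_ ?_ ?_ ?_ ?_
  · intro i j hi hj
    have h₁ : ¬ (o.arc i j (i + 1) j ∧ o.arc (i + 1) j (i + 1) (j + 1) ∧
        ¬ o.arc i (j + 1) (i + 1) (j + 1) ∧ ¬ o.arc i j i (j + 1)) := by
      rw [← o.arc_right_iff (by omega) (by omega), ← o.arc_up_iff (by omega) (by omega)]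
      exact fun h => hac.not_four_cycle h.1 h.2.1 h.2.2.1 h.2.2.2
    have h₂ : ¬ (o.arc i j i (j + 1) ∧ o.arc i (j + 1) (i + 1) (j + 1) ∧
        ¬ o.arc (i + 1) j (i + 1) (j + 1) ∧ ¬ o.arc i j (i + 1) j) := by
      rw [← o.arc_right_iff (by omega) (by omega), ← o.arc_up_iff (by omega) (by omega)]
      exact fun h => hac.not_four_cycle h.1 h.2.1 h.2.2.1 h.2.2.2
    grind
  · intro i j hi hj
    have h := parint i j hi hj
    grind
  · intro i j hi hj
    have h := parint i j hi hj
    grind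
  · intro k hk
    have h := (par (2 * k + 1) 0 (by omega) (by omega)).trans
      ((hbot k hk).trans (par (2 * k + 1 + 1) 0 (by omega) (by omega)).symm)
    rw [o.arc_right_iff (by omega) (by omega), o.arc_up_iff (by omega) (by omega),
      o.arc_right_iff (by omega) (by omega), o.arc_up_iff (by omega) (by omega)] at h
    simp only [Nat.succ_pos, true_and, Nat.add_sub_cancel, lt_irrefl, false_and, if_false] at h
    grind
  · intro k hk
    have h := (par (2 * k + 1) (2 * N + 1) (by omega) (by omega)).trans
      ((htop k hk).trans (par (2 * k + 1 + 1) (2 * N + 1) (by omega) (by omega)).symm)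
    rw [o.arc_right_iff (by omega) (by omega), o.arc_right_iff (by omega) (by omega)] at h
    simp only [Nat.succ_pos, true_and, Nat.add_sub_cancel, hye, if_false] at h
    grind
  · intro l hl
    have h := (par 0 (2 * l + 1) (by omega) (by omega)).trans
      ((hleft l hl).trans (par 0 (2 * l + 1 + 1) (by omega) (by omega)).symm)
    rw [o.arc_right_iff (by omega) (by omega), o.arc_up_iff (by omega) (by omega),
      o.arc_right_iff (by omega) (by omega), o.arc_up_iff (by omega) (by omega)] at h
    simp only [Nat.succ_pos, true_and, Nat.add_sub_cancel, lt_irrefl, false_and, if_false] at h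
    grind
  · intro l hl
    have h := (par (2 * M + 1) (2 * l + 1) (by omega) (by omega)).trans
      ((hright l hl).trans (par (2 * M + 1) (2 * l + 1 + 1) (by omega) (by omega)).symm)
    rw [o.arc_up_iff (by omega) (by omega), o.arc_up_iff (by omega) (by omega)] at h
    simp only [Nat.succ_pos, true_and, Nat.add_sub_cancel, hxe, if_false] at h
    grind
  · have h := (par 0 0 (by omega) (by omega)).2 h00
    rw [o.arc_right_iff (by omega) (by omega), o.arc_up_iff (by omega) (by omega)] at h
    grind
  · have h := (par (2 * M + 1) 0 (by omega) (by omega)).2 hp0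
    rw [o.arc_up_iff (by omega) (by omega)] at h
    simp only [Nat.succ_pos, true_and, Nat.add_sub_cancel, hxe] at h
    grind
  · have h := (par 0 (2 * N + 1) (by omega) (by omega)).2 h0q
    rw [o.arc_right_iff (by omega) (by omega)] at h
    simp only [Nat.succ_pos, true_and, Nat.add_sub_cancel, hye] at h
    grind
  · have h := (par (2 * M + 1) (2 * N + 1) (by omega) (by omega)).2 hpq
    simp only [Nat.succ_pos, true_and, Nat.add_sub_cancel, hxe, hye] at h
    grind
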